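/- The affine hypersurface Q ⊂ 𝔸⁴ defined by (w³ - 1)(t² - 1) = (z³ - 1)(s² - 1) with coordinates (t, s, z, w) is rational: its function field over ℂ is a purely transcendental extension of ℂ of transcendence degree 3. -/

import Mathlib

open MvPolynomial

/-- The defining equation of the affine quintic hypersurface
`Q : (w³-1)(t²-1) = (z³-1)(s²-1)` in `𝔸⁴` with coordinates `(t,s,z,w) = (X 0, X 1, X 2, X 3)`. -/
noncomputable def quinticQ : MvPolynomial (Fin 4) ℂ :=
  (X 3 ^ 3 - 1) * (X 0 ^ 2 - 1) - (X 2 ^ 3 - 1) * (X 1 ^ 2 - 1)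

theorem irreducible_quadratic_aux {D : Type*} [CommRing D] [IsDomain D] (a c π : D)
    (hπ : Prime π) (ha : π ∣ a) (ha2 : ¬ π * π ∣ a) (hc : ¬ π ∣ c)
    (hrel : ∀ x, x ∣ a → x ∣ c → IsUnit x) :
    Irreducible (Polynomial.C a * Polynomial.X ^ 2 + Polynomial.C c) := by
  have ha0 : a ≠ 0 := fun h => ha2 (h ▸ dvd_zero _)
  set p : Polynomial D := Polynomial.C a * Polynomial.X ^ 2 + Polynomial.C c with hp
  have hdeg : p.natDegree = 2 := by
    rw [hp]; compute_degree!
  have h2 : p.coeff 2 = a := by simp [hp, Polynomial.coeff_C]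
  have h1 : p.coeff 1 = 0 := by simp [hp, Polynomial.coeff_C, Polynomial.coeff_X_pow]
  have h0 : p.coeff 0 = c := by simp [hp]
  have hp0 : p ≠ 0 := by
    intro h; rw [h] at hdeg; simp at hdeg
  have key : ∀ α β γ δ : D, α * γ = a → β * δ = c → α * δ + β * γ = 0 → ¬ π ∣ α := by
    intro α β γ δ e1 e2 e3 h
    have hγ : ¬ π ∣ γ := fun h' => ha2 (e1 ▸ mul_dvd_mul h h')
    have : π ∣ β * γ := by
      have : β * γ = - (α * δ) := by linear_combination e3
      rw [this]
      exact (h.mul_right _).neg_right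
    rcases hπ.dvd_or_dvd this with h' | h'
    · exact hc (e2 ▸ h'.mul_right _)
    · exact hγ h'
  refine ⟨fun h => ?_, fun f g hfg => ?_⟩
  · have := Polynomial.natDegree_eq_zero_of_isUnit h
    omega
  · have hf0 : f ≠ 0 := by rintro rfl; simp at hfg; exact hp0 hfg
    have hg0 : g ≠ 0 := by rintro rfl; simp at hfg; exact hp0 hfg
    have hsum : f.natDegree + g.natDegree = 2 := by
      rw [← Polynomial.natDegree_mul hf0 hg0, ← hfg, hdeg]
    have const : ∀ f g : Polynomial D, p = f * g → f.natDegree = 0 → IsUnit f := by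
      intro f g hfg hf
      rw [Polynomial.eq_C_of_natDegree_eq_zero hf] at hfg ⊢
      rw [Polynomial.isUnit_C]
      apply hrel
      · rw [← h2, hfg, Polynomial.coeff_C_mul]; exact dvd_mul_right _ _
      · rw [← h0, hfg, Polynomial.coeff_C_mul]; exact dvd_mul_right _ _
    have : f.natDegree = 0 ∨ g.natDegree = 0 ∨ (f.natDegree = 1 ∧ g.natDegree = 1) := by omega
    rcases this with h | h | ⟨hf, hg⟩
    · exact Or.inl (const f g hfg h)
    · exact Or.inr (const g f (by rw [hfg, mul_comm]) h)
    · exfalso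
      have e : p = Polynomial.C (f.coeff 1 * g.coeff 1) * Polynomial.X ^ 2
          + Polynomial.C (f.coeff 1 * g.coeff 0 + f.coeff 0 * g.coeff 1) * Polynomial.X
          + Polynomial.C (f.coeff 0 * g.coeff 0) := by
        rw [hfg]
        conv_lhs => rw [Polynomial.eq_X_add_C_of_natDegree_le_one hf.le,
          Polynomial.eq_X_add_C_of_natDegree_le_one hg.le]
        simp only [map_mul, map_add]
        ring
      have e2 : f.coeff 1 * g.coeff 1 = a := by
        rw [← h2, e]; simp [Polynomial.coeff_C, Polynomial.coeff_X, -map_mul]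
      have e1 : f.coeff 1 * g.coeff 0 + f.coeff 0 * g.coeff 1 = 0 := by
        rw [← h1, e]; simp [Polynomial.coeff_C, Polynomial.coeff_X_pow, -map_mul]
      have e0 : f.coeff 0 * g.coeff 0 = c := by
        rw [← h0, e]; simp
      rw [← e2] at ha
      rcases hπ.dvd_or_dvd ha with h | h
      · exact key _ _ _ _ e2 e0 e1 h
      · exact key _ _ _ _ (by rw [mul_comm]; exact e2) (by rw [mul_comm]; exact e0)
          (by linear_combination e1) h

theorem prime_X_sub_C_aux (ω : ℂ) : Prime (X 2 - C ω : MvPolynomial (Fin 3) ℂ) := by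
  rw [← UniqueFactorizationMonoid.irreducible_iff_prime]
  have := irreducible_mul_X_add (1 : MvPolynomial (Fin 3) ℂ) (-C ω) 2 one_ne_zero
    (by simp) (by rw [← map_neg, vars_C]; simp) isRelPrime_one_left
  simpa [sub_eq_add_neg] using this

theorem exists_omega : ∃ ω : ℂ, ω ^ 2 + ω + 1 = 0 := by
  obtain ⟨r, hr⟩ := IsAlgClosed.exists_pow_nat_eq (-3 : ℂ) (n := 2) (by norm_num)
  exact ⟨(-1 + r) / 2, by linear_combination hr / 4⟩

theorem quinticQ_irreducible : Irreducible quinticQ := by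
  rw [← MulEquiv.irreducible_iff (finSuccEquiv ℂ 3)]
  have e : finSuccEquiv ℂ 3 quinticQ =
      Polynomial.C (X 2 ^ 3 - 1) * Polynomial.X ^ 2
        + Polynomial.C (-(X 2 ^ 3 - 1) - (X 1 ^ 3 - 1) * (X 0 ^ 2 - 1)) := by
    have e1 : finSuccEquiv ℂ 3 (X 1) = Polynomial.C (X 0) := finSuccEquiv_X_succ (j := 0)
    have e2 : finSuccEquiv ℂ 3 (X 2) = Polynomial.C (X 1) := finSuccEquiv_X_succ (j := 1)
    have e3 : finSuccEquiv ℂ 3 (X 3) = Polynomial.C (X 2) := finSuccEquiv_X_succ (j := 2)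
    simp only [quinticQ, map_sub, map_mul, map_pow, map_one, e1, e2, e3, finSuccEquiv_X_zero,
      map_neg]
    ring
  rw [e]
  obtain ⟨ω, hω⟩ := exists_omega
  have hω3 : ω ^ 3 = 1 := by linear_combination (ω - 1) * hω
  have fac : (X 2 ^ 3 - 1 : MvPolynomial (Fin 3) ℂ) =
      (X 2 - C 1) * ((X 2 - C ω) * (X 2 - C (-1 - ω))) := by
    have h := congrArg (C (σ := Fin 3)) hω
    simp only [map_add, map_pow, map_one, map_zero] at h
    simp only [map_sub, map_neg, map_one]
    linear_combination (X 2 - 1) * h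
  have ndvd : ∀ ζ : ℂ, ζ ^ 3 = 1 → ¬ (X 2 - C ζ : MvPolynomial (Fin 3) ℂ) ∣
      (-(X 2 ^ 3 - 1) - (X 1 ^ 3 - 1) * (X 0 ^ 2 - 1)) := by
    rintro ζ hζ ⟨g, hg⟩
    have := congrArg (eval ![0, 0, ζ]) hg
    simp [hζ] at this
  apply irreducible_quadratic_aux _ _ (X 2 - C 1) (prime_X_sub_C_aux 1)
  · rw [fac]; exact dvd_mul_right _ _
  · rintro ⟨g, hg⟩
    rw [fac, mul_assoc] at hg
    have := mul_left_cancel₀ (prime_X_sub_C_aux 1).ne_zero hg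
    have := congrArg (eval ![0, 0, 1]) this
    simp at this
    rcases this with h | h
    · have : ω = 1 := by linear_combination -h
      rw [this] at hω; norm_num at hω
    · have : ω = -2 := by linear_combination h
      rw [this] at hω; norm_num at hω
  · exact ndvd 1 (by norm_num)
  · intro x hxa hxc
    have hx0 : x ≠ 0 := by
      rintro rfl
      rw [zero_dvd_iff] at hxa
      have := congrArg (eval ![0, 0, 0]) hxa
      simp at this
    by_contra hu
    obtain ⟨π, hπ, hπx⟩ := WfDvdMonoid.exists_irreducible_factor hu hx0
    have hπp := hπ.prime
    have step : ∀ ζ : ℂ, ζ ^ 3 = 1 → ¬ π ∣ (X 2 - C ζ : MvPolynomial (Fin 3) ℂ) := by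
      intro ζ hζ h
      have := (hπp.associated_of_dvd (prime_X_sub_C_aux ζ) h).symm.dvd
      exact ndvd ζ hζ (this.trans (hπx.trans hxc))
    have h := hπx.trans hxa
    rw [fac] at h
    rcases hπp.dvd_or_dvd h with h | h
    · exact step 1 (by norm_num) h
    rcases hπp.dvd_or_dvd h with h | h
    · exact step ω hω3 h
    · exact step (-1 - ω) (by linear_combination (-ω - 2) * hω) h

theorem birational_aux {A P R L K : Type*} [CommRing A] [CommRing P] [IsDomain P] [CommRing R]
    [IsDomain A] [Field L] [Field K]
    [Algebra ℂ A] [Algebra ℂ P] [Algebra ℂ R] [Algebra ℂ L] [Algebra ℂ K]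
    [Algebra A L] [IsScalarTower ℂ A L] [IsFractionRing A L]
    [Algebra P K] [IsScalarTower ℂ P K] [IsFractionRing P K]
    (i : P →ₐ[ℂ] R)
    (ψ : R →ₐ[ℂ] L) (φ : A →ₐ[ℂ] R) (j : R →ₐ[ℂ] K) (hj : Function.Injective j)
    (hψφ : ∀ a, ψ (φ a) = algebraMap A L a)
    (hΦ : ∀ Φ : L →ₐ[ℂ] K, (∀ a, Φ (algebraMap A L a) = j (φ a)) →
      ∀ p, Φ (ψ (i p)) = algebraMap P K p) :
    Nonempty (L ≃ₐ[ℂ] K) := by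
  have hφ : Function.Injective φ := by
    intro a b h
    apply IsFractionRing.injective A L
    rw [← hψφ, ← hψφ, h]
  have hinj : Function.Injective (j.comp φ) := hj.comp hφ
  let Φ : L →ₐ[ℂ] K := IsFractionRing.liftAlgHom hinj
  have h := hΦ Φ (fun a => by simp [Φ])
  refine ⟨AlgEquiv.ofBijective Φ ⟨Φ.toRingHom.injective, fun k => ?_⟩⟩
  obtain ⟨x, y, hy, rfl⟩ := IsFractionRing.div_surjective (A := P) k
  exact ⟨ψ (i x) / ψ (i y), by rw [map_div₀, h, h]⟩

theorem quinticQ_ndvd (f : MvPolynomial (Fin 4) ℂ) (hf : eval ![2, -2, 0, 0] f ≠ 0) :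
    Ideal.Quotient.mk (Ideal.span {quinticQ}) f ≠ 0 := by
  rw [Ne, Ideal.Quotient.eq_zero_iff_mem, Ideal.mem_span_singleton]
  rintro ⟨g, rfl⟩
  apply hf
  simp [quinticQ]

/-- The denominator of the parametrization, in the coordinates `z, w, m`. -/
noncomputable def dQ : MvPolynomial (Fin 3) ℂ :=
  (X 1 ^ 3 - 1) - (X 0 ^ 3 - 1) * X 2 ^ 2

theorem rational_aux {L K R : Type*} [Field L] [Field K] [CommRing R]
    [IsDomain (MvPolynomial (Fin 4) ℂ ⧸ Ideal.span {quinticQ})]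
    [Algebra ℂ L] [Algebra ℂ K] [Algebra ℂ R]
    [Algebra (MvPolynomial (Fin 4) ℂ ⧸ Ideal.span {quinticQ}) L]
    [IsScalarTower ℂ (MvPolynomial (Fin 4) ℂ ⧸ Ideal.span {quinticQ}) L]
    [IsFractionRing (MvPolynomial (Fin 4) ℂ ⧸ Ideal.span {quinticQ}) L]
    [Algebra (MvPolynomial (Fin 3) ℂ) K] [IsScalarTower ℂ (MvPolynomial (Fin 3) ℂ) K]
    [IsFractionRing (MvPolynomial (Fin 3) ℂ) K]
    [Algebra (MvPolynomial (Fin 3) ℂ) R] [IsScalarTower ℂ (MvPolynomial (Fin 3) ℂ) R]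
    [IsLocalization.Away dQ R] : Nonempty (L ≃ₐ[ℂ] K) := by
  let q : MvPolynomial (Fin 4) ℂ →ₐ[ℂ] L :=
    (IsScalarTower.toAlgHom ℂ (MvPolynomial (Fin 4) ℂ ⧸ Ideal.span {quinticQ}) L).comp (Ideal.Quotient.mkₐ ℂ (Ideal.span {quinticQ}))
  have hq : ∀ f, eval ![2, -2, 0, 0] f ≠ 0 → q f ≠ 0 := by
    intro f hf h
    exact quinticQ_ndvd f hf ((IsFractionRing.injective (MvPolynomial (Fin 4) ℂ ⧸ Ideal.span {quinticQ}) L) (h.trans (map_zero _).symm))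
  have hq0 : q quinticQ = 0 := by
    have : Ideal.Quotient.mk (Ideal.span {quinticQ}) quinticQ = 0 := by
      rw [Ideal.Quotient.eq_zero_iff_mem]; exact Ideal.mem_span_singleton_self _
    change algebraMap (MvPolynomial (Fin 4) ℂ ⧸ Ideal.span {quinticQ}) L (Ideal.Quotient.mk (Ideal.span {quinticQ}) quinticQ) = 0
    rw [this, map_zero]
  have hrel : (q (X 3) ^ 3 - 1) * (q (X 0) ^ 2 - 1)
      = (q (X 2) ^ 3 - 1) * (q (X 1) ^ 2 - 1) := by
    rw [← sub_eq_zero, ← hq0]; simp [quinticQ]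
  have ht : q (X 0) - 1 ≠ 0 := by
    have := hq (X 0 - 1) (by simp; norm_num)
    simpa using this
  have hdq : (q (X 3) ^ 3 - 1) * (q (X 0) - 1) ^ 2
      - (q (X 2) ^ 3 - 1) * (q (X 1) - 1) ^ 2 ≠ 0 := by
    have := hq ((X 3 ^ 3 - 1) * (X 0 - 1) ^ 2 - (X 2 ^ 3 - 1) * (X 1 - 1) ^ 2)
      (by simp; norm_num)
    simpa using this
  -- coordinates of `MvPolynomial (Fin 3) ℂ`: `z = X 0`, `w = X 1`, `m = X 2`
  have hd : dQ ≠ 0 := by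
    intro h
    have := congrArg (eval ![0, 0, 0]) h
    simp [dQ] at this
  let ψ₀ : MvPolynomial (Fin 3) ℂ →ₐ[ℂ] L := aeval ![q (X 2), q (X 3), (q (X 1) - 1) / (q (X 0) - 1)]
  have hψd : ψ₀ dQ * (q (X 0) - 1) ^ 2 = (q (X 3) ^ 3 - 1) * (q (X 0) - 1) ^ 2
      - (q (X 2) ^ 3 - 1) * (q (X 1) - 1) ^ 2 := by
    have hm' : (q (X 1) - 1) / (q (X 0) - 1) * (q (X 0) - 1) = q (X 1) - 1 :=
      div_mul_cancel₀ _ ht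
    have e : ψ₀ dQ = (q (X 3) ^ 3 - 1)
        - (q (X 2) ^ 3 - 1) * ((q (X 1) - 1) / (q (X 0) - 1)) ^ 2 := by
      simp [ψ₀, dQ]
    rw [e, sub_mul, mul_assoc _ (_ ^ 2), ← mul_pow, hm']
  have hψd0 : ψ₀ dQ ≠ 0 := by
    intro h; apply hdq; rw [← hψd, h, zero_mul]
  let ψ : R →ₐ[ℂ] L := IsLocalization.Away.liftAlgHom dQ (f := ψ₀) (IsUnit.mk0 _ hψd0)
  let i : MvPolynomial (Fin 3) ℂ →ₐ[ℂ] R := IsScalarTower.toAlgHom ℂ (MvPolynomial (Fin 3) ℂ) R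
  have hψi : ∀ p, ψ (i p) = ψ₀ p := fun p => by simp [ψ, i]
  let j₀ : MvPolynomial (Fin 3) ℂ →ₐ[ℂ] K := IsScalarTower.toAlgHom ℂ (MvPolynomial (Fin 3) ℂ) K
  have hj₀ : Function.Injective j₀ := IsFractionRing.injective (MvPolynomial (Fin 3) ℂ) K
  have hj₀d : j₀ dQ ≠ 0 := fun h => hd (hj₀ (h.trans (map_zero _).symm))
  let j : R →ₐ[ℂ] K := IsLocalization.Away.liftAlgHom dQ (f := j₀) (IsUnit.mk0 _ hj₀d)
  have hji : ∀ p, j (i p) = j₀ p := fun p => by simp [j, i]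
  have hjinj : Function.Injective j := by
    rw [injective_iff_map_eq_zero]
    intro r hr
    obtain ⟨n, p, hp⟩ := IsLocalization.Away.surj dQ r
    have hp' : r * i dQ ^ n = i p := hp
    have : j₀ p = 0 := by rw [← hji, ← hp', map_mul, hr, zero_mul]
    have hp0 : p = 0 := hj₀ (this.trans (map_zero _).symm)
    rw [hp0, map_zero] at hp
    exact ((IsLocalization.Away.algebraMap_pow_isUnit dQ n).mul_left_eq_zero).1 hp
  let u : R := IsLocalization.Away.invSelf dQ
  have hu : i dQ * u = 1 := IsLocalization.Away.mul_invSelf dQ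
  let z : R := i (X 0)
  let w : R := i (X 1)
  let m : R := i (X 2)
  have hu' : ((w ^ 3 - 1) - (z ^ 3 - 1) * m ^ 2) * u = 1 := by
    simpa [dQ, z, w, m] using hu
  let pp : R := 2 * ((z ^ 3 - 1) * m - (w ^ 3 - 1)) * u
  let φ₀ : MvPolynomial (Fin 4) ℂ →ₐ[ℂ] R := aeval ![1 + pp, 1 + m * pp, z, w]
  have hφ₀ : φ₀ quinticQ = 0 := by
    simp [φ₀, quinticQ]
    simp only [pp]
    linear_combination (4 * ((z ^ 3 - 1) * m - (w ^ 3 - 1)) ^ 2 * u) * hu'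
  let φ : (MvPolynomial (Fin 4) ℂ ⧸ Ideal.span {quinticQ}) →ₐ[ℂ] R := Ideal.Quotient.liftₐ _ φ₀ (by
    intro a ha
    rw [Ideal.mem_span_singleton] at ha
    obtain ⟨g, rfl⟩ := ha
    rw [map_mul, hφ₀, zero_mul])
  have hφ : ∀ f, φ (Ideal.Quotient.mk _ f) = φ₀ f := fun f => rfl
  have hz : ψ z = q (X 2) := by simp only [z, hψi]; simp [ψ₀]
  have hw : ψ w = q (X 3) := by simp only [w, hψi]; simp [ψ₀]
  have hm : ψ m = (q (X 1) - 1) / (q (X 0) - 1) := by simp only [m, hψi]; simp [ψ₀]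
  have hpp : ψ pp = q (X 0) - 1 := by
    have h1 : ψ₀ dQ * ψ u = 1 := by rw [← hψi, ← map_mul, hu, map_one]
    have h2 : ψ pp * ψ₀ dQ = 2 * ((q (X 2) ^ 3 - 1) * ψ m - (q (X 3) ^ 3 - 1)) := by
      simp only [pp, map_mul, map_sub, map_pow, map_one, hz, hw, map_ofNat]
      linear_combination (2 * ((q (X 2) ^ 3 - 1) * ψ m - (q (X 3) ^ 3 - 1))) * h1
    apply mul_right_cancel₀ hψd0
    apply mul_right_cancel₀ (pow_ne_zero 2 ht)
    have h3 : ψ m * (q (X 0) - 1) = q (X 1) - 1 := by rw [hm]; exact div_mul_cancel₀ _ ht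
    rw [h2, mul_assoc (q (X 0) - 1), hψd]
    linear_combination (2 * (q (X 2) ^ 3 - 1) * (q (X 0) - 1)) * h3 - (q (X 0) - 1) * hrel
  have hcomp : ψ.comp φ₀ = q := by
    apply MvPolynomial.algHom_ext
    intro k
    fin_cases k
    · simp [φ₀, hpp]
    · simp [φ₀, hpp, hm, div_mul_cancel₀ _ ht]
    · simp [φ₀, hz]
    · simp [φ₀, hw]
  refine birational_aux (A := (MvPolynomial (Fin 4) ℂ ⧸ Ideal.span {quinticQ})) (P := MvPolynomial (Fin 3) ℂ) (R := R) (L := L) (K := K) i ψ φ j hjinj ?_ ?_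
  · intro a
    obtain ⟨f, rfl⟩ := Ideal.Quotient.mk_surjective a
    rw [hφ]
    exact DFunLike.congr_fun hcomp f
  · intro Φ hΦ
    have hΦq : ∀ f, Φ (q f) = j (φ₀ f) := fun f => by
      rw [← hφ]; exact hΦ (Ideal.Quotient.mk _ f)
    have hjpp : j pp ≠ 0 := by
      intro h
      apply ht
      apply Φ.toRingHom.injective
      change Φ _ = Φ _
      rw [map_sub, hΦq, map_one, map_zero]
      simp [φ₀, h]
    have : (Φ.comp (ψ.comp i)) = j₀ := by
      apply MvPolynomial.algHom_ext
      intro k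
      fin_cases k
      · change Φ (ψ z) = _
        rw [hz, hΦq]; simp [φ₀, z, hji]
      · change Φ (ψ w) = _
        rw [hw, hΦq]; simp [φ₀, w, hji]
      · change Φ (ψ m) = _
        rw [hm, map_div₀, map_sub, map_sub, hΦq, hΦq]; simp [φ₀, hjpp, m, hji]
    intro p
    exact DFunLike.congr_fun this p

/-- The hypersurface `Q` is rational: its function field is a purely transcendental
extension of ℂ of transcendence degree 3, i.e. it is ℂ-isomorphic to the fraction field
of a polynomial ring in three variables. -/
theorem Q_rational :
    Nonempty
      ((FractionRing (MvPolynomial (Fin 4) ℂ ⧸ Ideal.span {quinticQ}))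
        ≃ₐ[ℂ] FractionRing (MvPolynomial (Fin 3) ℂ)) := by
  have hprime : (Ideal.span {quinticQ}).IsPrime := by
    rw [Ideal.span_singleton_prime quinticQ_irreducible.ne_zero]
    exact quinticQ_irreducible.prime
  exact rational_aux (R := Localization.Away dQ)
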